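/- Characterization of conformal harmonic coordinates as harmonic coordinates of a scalar-flat conformal metric (Proposition 2.4, coordinate version): Let n ≥ 3, k ∈ ℕ with k ≥ 2, α ∈ (0,1), let g be a metric of class C^{k+α} on an open set U ⊆ ℝⁿ, and set p = 2n/(n−2). Let Z = (Z¹, …, Zⁿ) : U → ℝⁿ be a C² map which is a local diffeomorphism onto its image. Then the following are equivalent: (i) there exist functions f¹, …, fⁿ, f ∈ C²(U) with f > 0, L_g f¹ = ⋯ = L_g fⁿ = L_g f = 0 on U, and Z^k = f^k/f on U for every k = 1, …, n; (ii) there exists a positive function f ∈ C²(U) such that the conformally rescaled metric f^{p−2} g has identically vanishing scalar curvature on U, R(f^{p−2} g) = 0, and each coordinate function Z^k is harmonic for it, i.e. Δ_{f^{p−2} g} Z^k = 0 on U for every k = 1, …, n. -/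

import Mathlib

noncomputable section

open Set Matrix Matrix

/-- Points of `ℝⁿ`. -/
abbrev Pt (n : ℕ) := Fin n → ℝ

/-- A metric in coordinates: a matrix-valued map. -/
abbrev Met (n : ℕ) := Pt n → Matrix (Fin n) (Fin n) ℝ

/-- Partial derivative of `f` in the `a`-th coordinate direction. -/
def pd {n : ℕ} (a : Fin n) (f : Pt n → ℝ) (x : Pt n) : ℝ :=
  fderiv ℝ f x (Pi.single a 1)

/-- `g` is a metric (pointwise symmetric positive definite) on `U`. -/
def IsMetricOn {n : ℕ} (g : Met n) (U : Set (Pt n)) : Prop :=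
  ∀ x ∈ U, (g x).IsSymm ∧ (g x).PosDef

/-- Christoffel symbols `Γ^c_{ab}` of `g`. -/
def christoffel {n : ℕ} (g : Met n) (c a b : Fin n) (x : Pt n) : ℝ :=
  (1 / 2) * ∑ d, (g x)⁻¹ c d *
    (pd a (fun y => g y b d) x + pd b (fun y => g y a d) x - pd d (fun y => g y a b) x)

/-- Ricci tensor `R_{ab}` of `g`. -/
def ricci {n : ℕ} (g : Met n) (a b : Fin n) (x : Pt n) : ℝ :=
  (∑ c, pd c (christoffel g c a b) x) - (∑ c, pd a (christoffel g c c b) x)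
    + (∑ c, ∑ d, christoffel g c a b x * christoffel g d d c x)
    - (∑ c, ∑ d, christoffel g d c b x * christoffel g c a d x)

/-- Scalar curvature `R(g)`. -/
def scalarCurv {n : ℕ} (g : Met n) (x : Pt n) : ℝ :=
  ∑ a, ∑ b, (g x)⁻¹ a b * ricci g a b x

/-- Laplace–Beltrami operator `Δ_g`. -/
def laplaceBeltrami {n : ℕ} (g : Met n) (u : Pt n → ℝ) (x : Pt n) : ℝ :=
  -(Real.sqrt (g x).det)⁻¹ *
    ∑ a, pd a (fun y => Real.sqrt (g y).det * ∑ b, (g y)⁻¹ a b * pd b u y) x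

/-- Conformal Laplacian `L_g`. -/
def confLap {n : ℕ} (g : Met n) (u : Pt n → ℝ) (x : Pt n) : ℝ :=
  laplaceBeltrami g u x + (((n : ℝ) - 2) / (4 * ((n : ℝ) - 1))) * scalarCurv g x * u x

/-- `f` is of class `C^{k+α}` on `s`: it is `C^k` there and its `k`-th order derivatives are
locally `α`-Hölder continuous. -/
def CHolderOn {n : ℕ} (k : ℕ) (α : ℝ) (s : Set (Pt n)) (f : Pt n → ℝ) : Prop :=
  ContDiffOn ℝ k f s ∧
    ∀ x ∈ s, ∃ C : NNReal, ∃ t ∈ nhdsWithin x s,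
      HolderOnWith C (Real.toNNReal α) (iteratedFDerivWithin ℝ k f s) t

/-- All entries of `g` are of class `C^{k+α}` on `s`. -/
def MetCHolderOn {n : ℕ} (k : ℕ) (α : ℝ) (s : Set (Pt n)) (g : Met n) : Prop :=
  ∀ a b, CHolderOn k α s fun x => g x a b

/-- Contracted Christoffel symbol `Γ^a = g^{bc} Γ^a_{bc}`. -/
def gammaUp {n : ℕ} (g : Met n) (a : Fin n) (x : Pt n) : ℝ :=
  ∑ b, ∑ c, (g x)⁻¹ b c * christoffel g a b c x

/-- Contracted Christoffel symbol `Γ_a = g_{ab} Γ^b`. -/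
def gammaLow {n : ℕ} (g : Met n) (a : Fin n) (x : Pt n) : ℝ :=
  ∑ b, g x a b * gammaUp g b x

/-- `g` satisfies the conformal harmonic gauge on `U`. -/
def ConfHarmonicGauge {n : ℕ} (g : Met n) (U : Set (Pt n)) : Prop :=
  ∃ f : Pt n → ℝ, ContDiffOn ℝ 2 f U ∧ (∀ x ∈ U, 0 < f x) ∧
    (∀ x ∈ U, confLap g f x = 0) ∧
    ∀ a : Fin n, ∀ x ∈ U, gammaLow g a x = 2 * pd a (fun y => Real.log (f y)) x

/-- Determinant-normalized metric `ĝ = (det g)^{-1/n} g`. -/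
def dnorm {n : ℕ} (g : Met n) : Met n :=
  fun x => ((g x).det ^ (-(1 : ℝ) / (n : ℝ))) • g x

/-- Jacobian matrix of a map `Z : ℝⁿ → ℝⁿ`. -/
def jac {n : ℕ} (Z : Pt n → Pt n) (x : Pt n) : Matrix (Fin n) (Fin n) ℝ :=
  Matrix.of fun i j => pd j (fun y => Z y i) x

/-- Riemann curvature tensor `R_{abc}{}^{d}`. -/
def riemannUp {n : ℕ} (g : Met n) (a b c d : Fin n) (x : Pt n) : ℝ :=
  pd a (christoffel g d b c) x - pd b (christoffel g d a c) x
    + (∑ e, christoffel g e b c x * christoffel g d a e x)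
    - (∑ e, christoffel g e a c x * christoffel g d b e x)

/-- Riemann curvature tensor `R_{abcd} = R_{abc}{}^{e} g_{ed}`. -/
def riemannLow {n : ℕ} (g : Met n) (a b c d : Fin n) (x : Pt n) : ℝ :=
  ∑ e, riemannUp g a b c e x * g x e d

/-- Schouten tensor `P_{ab}`. -/
def schouten {n : ℕ} (g : Met n) (a b : Fin n) (x : Pt n) : ℝ :=
  (1 / ((n : ℝ) - 2)) * (ricci g a b x - (scalarCurv g x / (2 * ((n : ℝ) - 1))) * g x a b)

/-- Weyl tensor `W_{abcd}`. -/
def weyl {n : ℕ} (g : Met n) (a b c d : Fin n) (x : Pt n) : ℝ :=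
  riemannLow g a b c d x + schouten g a c x * g x b d - schouten g b c x * g x a d
    + schouten g b d x * g x a c - schouten g a d x * g x b c

/-- Weyl tensor with raised last index, `W_{abc}{}^{d} = g^{de} W_{abce}`. -/
def weylUp {n : ℕ} (g : Met n) (a b c d : Fin n) (x : Pt n) : ℝ :=
  ∑ e, (g x)⁻¹ d e * weyl g a b c e x

/-- Covariant derivative of a 2-tensor: `(∇T)_{cab} = ∇_c T_{ab}`. -/
def cov2 {n : ℕ} (g : Met n) (T : Fin n → Fin n → Pt n → ℝ) (c a b : Fin n) (x : Pt n) : ℝ :=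
  pd c (T a b) x - (∑ d, christoffel g d c a x * T d b x)
    - ∑ d, christoffel g d c b x * T a d x

/-- Covariant derivative of a 3-tensor: `(∇T)_{dabc} = ∇_d T_{abc}`. -/
def cov3 {n : ℕ} (g : Met n) (T : Fin n → Fin n → Fin n → Pt n → ℝ) (d a b c : Fin n)
    (x : Pt n) : ℝ :=
  pd d (T a b c) x - (∑ e, christoffel g e d a x * T e b c x)
    - (∑ e, christoffel g e d b x * T a e c x)
    - ∑ e, christoffel g e d c x * T a b e x

/-- Cotton tensor `C_{abc} = ∇_a P_{bc} - ∇_b P_{ac}`. -/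
def cotton {n : ℕ} (g : Met n) (a b c : Fin n) (x : Pt n) : ℝ :=
  cov2 g (schouten g) a b c x - cov2 g (schouten g) b a c x

/-- Bach tensor `B_{ab}`. -/
def bach {n : ℕ} (g : Met n) (a b : Fin n) (x : Pt n) : ℝ :=
  (∑ c, ∑ d, (g x)⁻¹ c d *
      (cov3 g (cov2 g (schouten g)) d a b c x - cov3 g (cov2 g (schouten g)) d c a b x))
    + ∑ c, ∑ d, ∑ e, ∑ f, (g x)⁻¹ c e * (g x)⁻¹ d f * schouten g e f x * weyl g a c d b x

section PartialDerivatives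

variable {n : ℕ} {x : Pt n} {U : Set (Pt n)}

theorem pd_congr {u v : Pt n → ℝ} (a : Fin n) (hU : IsOpen U) (hx : x ∈ U)
    (h : ∀ y ∈ U, u y = v y) : pd a u x = pd a v x := by
  have : u =ᶠ[nhds x] v := Filter.eventually_of_mem (hU.mem_nhds hx) h
  simp only [pd, this.fderiv_eq]

theorem pd_const (a : Fin n) (c : ℝ) : pd a (fun _ => c) x = 0 := by
  simp [pd]

theorem pd_add {u v : Pt n → ℝ} (a : Fin n) (hu : DifferentiableAt ℝ u x)
    (hv : DifferentiableAt ℝ v x) : pd a (fun y => u y + v y) x = pd a u x + pd a v x := by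
  simp [pd, fderiv_fun_add hu hv]

theorem pd_mul {u v : Pt n → ℝ} (a : Fin n) (hu : DifferentiableAt ℝ u x)
    (hv : DifferentiableAt ℝ v x) :
    pd a (fun y => u y * v y) x = pd a u x * v x + u x * pd a v x := by
  simp [pd, fderiv_fun_mul hu hv]; ring

theorem pd_const_mul {u : Pt n → ℝ} (a : Fin n) (c : ℝ) (hu : DifferentiableAt ℝ u x) :
    pd a (fun y => c * u y) x = c * pd a u x := by
  rw [pd_mul a (differentiableAt_const c) hu, pd_const]; ring

theorem pd_sum {ι : Type*} {s : Finset ι} {u : ι → Pt n → ℝ} (a : Fin n)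
    (hu : ∀ i ∈ s, DifferentiableAt ℝ (u i) x) :
    pd a (fun y => ∑ i ∈ s, u i y) x = ∑ i ∈ s, pd a (u i) x := by
  simp [pd, fderiv_fun_sum hu]

theorem pd_comp {φ : ℝ → ℝ} {φ' : ℝ} {u : Pt n → ℝ} (a : Fin n) (hφ : HasDerivAt φ φ' (u x))
    (hu : DifferentiableAt ℝ u x) : pd a (fun y => φ (u y)) x = φ' * pd a u x := by
  have := (hφ.comp_hasFDerivAt x hu.hasFDerivAt).fderiv
  simp only [pd]
  change (fderiv ℝ (φ ∘ u) x) _ = _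
  rw [this]; simp

theorem ContDiffOn.differentiableAt_of_isOpen {u : Pt n → ℝ} {m : WithTop ℕ∞} (hu : ContDiffOn ℝ m u U) (hm : m ≠ 0)
    (hU : IsOpen U) (hx : x ∈ U) : DifferentiableAt ℝ u x :=
  (hu.differentiableOn hm).differentiableAt (hU.mem_nhds hx)

theorem contDiffOn_pd {u : Pt n → ℝ} (hu : ContDiffOn ℝ 2 u U) (hU : IsOpen U) (a : Fin n) :
    ContDiffOn ℝ 1 (pd a u) U :=
  (hu.fderiv_of_isOpen hU (by norm_num)).clm_apply contDiffOn_const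

end PartialDerivatives

section MatrixCalculus

variable {n : ℕ} {U : Set (Pt n)} {g : Met n}

theorem contDiffOn_det {m : WithTop ℕ∞} (hg : ∀ a b, ContDiffOn ℝ m (fun y => g y a b) U) :
    ContDiffOn ℝ m (fun y => (g y).det) U := by
  simp only [Matrix.det_apply']
  exact ContDiffOn.sum fun σ _ => contDiffOn_const.mul (contDiffOn_prod fun i _ => hg _ _)

theorem contDiffOn_adjugate {m : WithTop ℕ∞} (hg : ∀ a b, ContDiffOn ℝ m (fun y => g y a b) U)
    (a b : Fin n) : ContDiffOn ℝ m (fun y => (g y).adjugate a b) U := by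
  simp only [Matrix.adjugate_apply]
  refine contDiffOn_det (g := fun y => (g y).updateRow b (Pi.single a 1)) fun i j => ?_
  by_cases h : i = b
  · subst h; simpa using contDiffOn_const
  · simpa [Matrix.updateRow_ne h] using hg i j

theorem contDiffOn_matrix_inv {m : WithTop ℕ∞} (hg : ∀ a b, ContDiffOn ℝ m (fun y => g y a b) U)
    (hd : ∀ y ∈ U, (g y).det ≠ 0) (a b : Fin n) :
    ContDiffOn ℝ m (fun y => (g y)⁻¹ a b) U := by
  simp only [Matrix.inv_def, Matrix.smul_apply, Ring.inverse_eq_inv', smul_eq_mul]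
  exact ((contDiffOn_det hg).inv hd).mul (contDiffOn_adjugate hg a b)

theorem pd_det {x : Pt n} (hg : ∀ a b, DifferentiableAt ℝ (fun y => g y a b) x) (a : Fin n) :
    pd a (fun y => (g y).det) x
      = ∑ i, ∑ j, (g x).adjugate j i * pd a (fun y => g y i j) x := by
  let D : ContinuousMultilinearMap ℝ (fun _ : Fin n => Fin n → ℝ) ℝ :=
    ⟨(Matrix.detRowAlternating : (Fin n → ℝ) [⋀^Fin n]→ₗ[ℝ] ℝ).toMultilinearMap,
      Continuous.matrix_det (A := fun M : Matrix (Fin n) (Fin n) ℝ => M) continuous_id⟩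
  let G : Pt n → Fin n → Fin n → ℝ := fun y i j => g y i j
  have hG : HasFDerivAt G (ContinuousLinearMap.pi fun i => ContinuousLinearMap.pi fun j =>
      fderiv ℝ (fun y => g y i j) x) x :=
    hasFDerivAt_pi.2 fun i => hasFDerivAt_pi.2 fun j => (hg i j).hasFDerivAt
  have h := ((D.hasFDerivAt (G x)).comp x hG).fderiv
  have e : (fun y => (g y).det) = (D ∘ G) := rfl
  simp only [pd, e, h]
  simp only [ContinuousLinearMap.comp_apply, ContinuousMultilinearMap.linearDeriv_apply]
  refine Finset.sum_congr rfl fun i _ => ?_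
  change ((g x).updateRow i _).det = _
  rw [← Matrix.cramer_transpose_apply, Matrix.cramer_eq_adjugate_mulVec, Matrix.mulVec,
    dotProduct]
  refine Finset.sum_congr rfl fun j _ => ?_
  rw [← Matrix.adjugate_transpose]
  rfl

end MatrixCalculus

section Metric

variable {n : ℕ} {U : Set (Pt n)} {g : Met n} {x : Pt n}

theorem IsMetricOn.det_pos (hgm : IsMetricOn g U) (hx : x ∈ U) : 0 < (g x).det :=
  (hgm x hx).2.det_pos

theorem IsMetricOn.inv_mul (hgm : IsMetricOn g U) (hx : x ∈ U) : (g x)⁻¹ * g x = 1 :=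
  Matrix.nonsing_inv_mul _ (hgm.det_pos hx).ne'.isUnit

theorem IsMetricOn.mul_inv (hgm : IsMetricOn g U) (hx : x ∈ U) : g x * (g x)⁻¹ = 1 :=
  Matrix.mul_nonsing_inv _ (hgm.det_pos hx).ne'.isUnit

theorem IsMetricOn.symm (hgm : IsMetricOn g U) (hx : x ∈ U) (a b : Fin n) :
    g x a b = g x b a :=
  (hgm x hx).1.apply b a

theorem IsMetricOn.inv_symm (hgm : IsMetricOn g U) (hx : x ∈ U) (a b : Fin n) :
    (g x)⁻¹ a b = (g x)⁻¹ b a := by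
  have h : ((g x)⁻¹)ᵀ = (g x)⁻¹ := by
    rw [Matrix.transpose_nonsing_inv, (hgm x hx).1.eq]
  exact congrFun (congrFun h b) a

theorem IsMetricOn.pd_symm (hgm : IsMetricOn g U) (hU : IsOpen U) (hx : x ∈ U) (c a b : Fin n) :
    pd c (fun y => g y a b) x = pd c (fun y => g y b a) x :=
  pd_congr c hU hx fun _ hy => hgm.symm hy a b

theorem christoffel_symm (hgm : IsMetricOn g U) (hU : IsOpen U) (hx : x ∈ U) (c a b : Fin n) :
    christoffel g c a b x = christoffel g c b a x := by
  simp only [christoffel, hgm.pd_symm hU hx _ a b]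
  congr 1
  refine Finset.sum_congr rfl fun d _ => ?_
  ring

theorem sum_mul_christoffel (hgm : IsMetricOn g U) (hx : x ∈ U) (e a b : Fin n) :
    ∑ c, g x e c * christoffel g c a b x
      = (1 / 2) * (pd a (fun y => g y b e) x + pd b (fun y => g y a e) x
        - pd e (fun y => g y a b) x) := by
  let v : Fin n → ℝ := fun d =>
    pd a (fun y => g y b d) x + pd b (fun y => g y a d) x - pd d (fun y => g y a b) x
  have h : g x *ᵥ ((g x)⁻¹ *ᵥ v) = v := by
    rw [Matrix.mulVec_mulVec, hgm.mul_inv hx, Matrix.one_mulVec]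
  have h' := congrFun h e
  simp only [Matrix.mulVec, dotProduct] at h'
  change _ = (1 / 2) * v e
  rw [← h', Finset.mul_sum]
  refine Finset.sum_congr rfl fun c _ => ?_
  simp only [christoffel, v]
  ring

theorem pd_metric (hgm : IsMetricOn g U) (hU : IsOpen U) (hx : x ∈ U) (c a b : Fin n) :
    pd c (fun y => g y a b) x
      = ∑ e, g x a e * christoffel g e c b x + ∑ e, g x b e * christoffel g e c a x := by
  rw [sum_mul_christoffel hgm hx, sum_mul_christoffel hgm hx, hgm.pd_symm hU hx c b a]
  ring

theorem pd_inv_metric (hgm : IsMetricOn g U) (hU : IsOpen U)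
    (hg : ∀ a b, ContDiffOn ℝ 2 (fun y => g y a b) U) (hx : x ∈ U) (c a b : Fin n) :
    pd c (fun y => (g y)⁻¹ a b) x
      = -(∑ e, christoffel g a c e x * (g x)⁻¹ e b
        + ∑ e, christoffel g b c e x * (g x)⁻¹ e a) := by
  let A := (g x)⁻¹
  let E : Matrix (Fin n) (Fin n) ℝ := Matrix.of fun i j => pd c (fun y => (g y)⁻¹ i j) x
  let D : Matrix (Fin n) (Fin n) ℝ := Matrix.of fun i j => pd c (fun y => g y i j) x
  let K : Matrix (Fin n) (Fin n) ℝ := Matrix.of fun i j => christoffel g i c j x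
  have hgd : ∀ i j, DifferentiableAt ℝ (fun y => g y i j) x := fun i j =>
    (hg i j).differentiableAt_of_isOpen two_ne_zero hU hx
  have hid : ∀ i j, DifferentiableAt ℝ (fun y => (g y)⁻¹ i j) x := fun i j =>
    (contDiffOn_matrix_inv hg (fun y hy => (hgm.det_pos hy).ne') i j).differentiableAt_of_isOpen
      two_ne_zero hU hx
  have hD : D = g x * K + Kᵀ * g x := by
    ext i j
    simp only [D, K, Matrix.of_apply, Matrix.add_apply, Matrix.mul_apply, Matrix.transpose_apply]
    rw [pd_metric hgm hU hx]
    congr 1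
    refine Finset.sum_congr rfl fun e _ => ?_
    rw [hgm.symm hx j e, mul_comm]
  have hE : E * g x + A * D = 0 := by
    ext i j
    have h0 : pd c (fun y => ∑ e, (g y)⁻¹ i e * g y e j) x = 0 := by
      rw [pd_congr (v := fun _ => (1 : Matrix (Fin n) (Fin n) ℝ) i j) c hU hx, pd_const]
      intro y hy
      rw [← hgm.inv_mul hy, Matrix.mul_apply]
    rw [pd_sum c fun e _ => (hid i e).fun_mul (hgd e j)] at h0
    simp only [fun e => pd_mul c (hid i e) (hgd e j), Finset.sum_add_distrib] at h0
    simpa [E, A, D, Matrix.mul_apply] using h0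
  have hE' : E = -(K * A + A * Kᵀ) := by
    have h1 : (E * g x + A * D) * A = 0 := by rw [hE, zero_mul]
    have h2 : (E * g x + A * D) * A = E * (g x * A) + (A * g x) * K * A + A * Kᵀ * (g x * A) := by
      rw [hD]; noncomm_ring
    rw [h2, hgm.mul_inv hx, hgm.inv_mul hx, mul_one, one_mul, mul_one] at h1
    rw [eq_neg_iff_add_eq_zero, ← h1]; abel
  have h := congrFun (congrFun hE' a) b
  simp only [E, K, A, Matrix.of_apply, Matrix.neg_apply, Matrix.add_apply, Matrix.mul_apply,
    Matrix.transpose_apply] at h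
  rw [h]
  congr 2
  refine Finset.sum_congr rfl fun e _ => ?_
  rw [hgm.inv_symm hx a e, mul_comm]

theorem christoffel_trace (hgm : IsMetricOn g U) (hU : IsOpen U) (hx : x ∈ U) (a : Fin n) :
    ∑ d, christoffel g d d a x
      = (1 / 2) * ∑ c, ∑ d, (g x)⁻¹ c d * pd a (fun y => g y c d) x := by
  have h : ∑ c, ∑ d, (g x)⁻¹ c d * pd c (fun y => g y a d) x
      = ∑ c, ∑ d, (g x)⁻¹ c d * pd d (fun y => g y c a) x := by
    rw [Finset.sum_comm]
    refine Finset.sum_congr rfl fun c _ => Finset.sum_congr rfl fun d _ => ?_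
    rw [hgm.inv_symm hx, hgm.pd_symm hU hx]
  simp only [christoffel, ← Finset.mul_sum, mul_add, mul_sub, Finset.sum_add_distrib,
    Finset.sum_sub_distrib, h]
  ring

theorem pd_sqrt_det (hgm : IsMetricOn g U) (hU : IsOpen U)
    (hg : ∀ a b, ContDiffOn ℝ 2 (fun y => g y a b) U) (hx : x ∈ U) (a : Fin n) :
    pd a (fun y => Real.sqrt (g y).det) x
      = Real.sqrt (g x).det * ∑ d, christoffel g d d a x := by
  have hp := hgm.det_pos hx
  have hgd : ∀ i j, DifferentiableAt ℝ (fun y => g y i j) x := fun i j =>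
    (hg i j).differentiableAt_of_isOpen two_ne_zero hU hx
  have hadj : ∀ i j, (g x).adjugate i j = (g x).det * (g x)⁻¹ i j := by
    intro i j
    rw [Matrix.inv_def, Matrix.smul_apply, Ring.inverse_eq_inv', smul_eq_mul,
      mul_inv_cancel_left₀ hp.ne']
  rw [pd_comp a (Real.hasDerivAt_sqrt hp.ne')
    ((contDiffOn_det hg).differentiableAt_of_isOpen two_ne_zero hU hx), pd_det hgd,
    christoffel_trace hgm hU hx]
  simp only [hadj, fun i j => hgm.inv_symm hx j i, mul_assoc, ← Finset.mul_sum]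
  have hs : Real.sqrt (g x).det ≠ 0 := (Real.sqrt_pos.2 hp).ne'
  have hss : (g x).det = Real.sqrt (g x).det * Real.sqrt (g x).det :=
    (Real.mul_self_sqrt hp.le).symm
  generalize Real.sqrt (g x).det = s at *
  rw [hss]
  field_simp

/-- The divergence `∇_c X^c` of a vector field, in coordinates. -/
def divergence (g : Met n) (X : Fin n → Pt n → ℝ) (x : Pt n) : ℝ :=
  ∑ c, (pd c (X c) x + (∑ d, christoffel g d d c x) * X c x)

/-- Index raising `ω^c = g^{cd} ω_d`. -/
def raise (g : Met n) (om : Fin n → Pt n → ℝ) (c : Fin n) (x : Pt n) : ℝ :=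
  ∑ d, (g x)⁻¹ c d * om d x

theorem contDiffOn_raise (hgm : IsMetricOn g U)
    (hg : ∀ a b, ContDiffOn ℝ 2 (fun y => g y a b) U) {om : Fin n → Pt n → ℝ}
    (hom : ∀ a, ContDiffOn ℝ 1 (om a) U) (c : Fin n) : ContDiffOn ℝ 1 (raise g om c) U :=
  ContDiffOn.sum fun d _ => ((contDiffOn_matrix_inv hg (fun y hy => (hgm.det_pos hy).ne')
    c d).of_le (by norm_num)).mul (hom d)

theorem laplaceBeltrami_eq_neg_divergence (hgm : IsMetricOn g U) (hU : IsOpen U)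
    (hg : ∀ a b, ContDiffOn ℝ 2 (fun y => g y a b) U) (hx : x ∈ U) {u : Pt n → ℝ}
    (hu : ContDiffOn ℝ 2 u U) :
    laplaceBeltrami g u x = -divergence g (raise g fun b => pd b u) x := by
  have hp := hgm.det_pos hx
  have hs : Real.sqrt (g x).det ≠ 0 := (Real.sqrt_pos.2 hp).ne'
  have hsd : DifferentiableAt ℝ (fun y => Real.sqrt (g y).det) x :=
    ((contDiffOn_det hg).differentiableAt_of_isOpen two_ne_zero hU hx).sqrt hp.ne'
  have hV : ∀ a, DifferentiableAt ℝ (raise g (fun b => pd b u) a) x := fun a =>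
    (contDiffOn_raise hgm hg (fun b => contDiffOn_pd hu hU b) a).differentiableAt_of_isOpen
      one_ne_zero hU hx
  change -(Real.sqrt (g x).det)⁻¹ *
    ∑ a, pd a (fun y => Real.sqrt (g y).det * raise g (fun b => pd b u) a y) x = _
  simp only [fun a => pd_mul a hsd (hV a), pd_sqrt_det hgm hU hg hx, divergence]
  rw [neg_mul, Finset.mul_sum]
  congr 1
  refine Finset.sum_congr rfl fun a _ => ?_
  field_simp
  ring

theorem divergence_raise (hgm : IsMetricOn g U) (hU : IsOpen U)
    (hg : ∀ a b, ContDiffOn ℝ 2 (fun y => g y a b) U) (hx : x ∈ U) {om : Fin n → Pt n → ℝ}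
    (hom : ∀ a, ContDiffOn ℝ 1 (om a) U) :
    divergence g (raise g om) x
      = ∑ a, ∑ b, (g x)⁻¹ a b * (pd a (om b) x - ∑ c, christoffel g c a b x * om c x) := by
  have hid : ∀ i j, DifferentiableAt ℝ (fun y => (g y)⁻¹ i j) x := fun i j =>
    (contDiffOn_matrix_inv hg (fun y hy => (hgm.det_pos hy).ne') i j).differentiableAt_of_isOpen
      two_ne_zero hU hx
  have hod : ∀ a, DifferentiableAt ℝ (om a) x := fun a =>
    (hom a).differentiableAt_of_isOpen one_ne_zero hU hx
  have h1 : ∀ c, pd c (raise g om c) x = ∑ d, (pd c (fun y => (g y)⁻¹ c d) x * om d x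
      + (g x)⁻¹ c d * pd c (om d) x) := by
    intro c
    rw [Finset.sum_congr rfl fun d _ => (pd_mul c (hid c d) (hod d)).symm]
    exact pd_sum c fun d _ => (hid c d).fun_mul (hod d)
  have h2 : ∑ c, ∑ d, (∑ e, christoffel g c c e x * (g x)⁻¹ e d) * om d x
      = ∑ c, (∑ d, christoffel g d d c x) * raise g om c x := by
    simp only [raise, Finset.sum_mul]
    refine (Finset.sum_congr rfl fun c _ => Finset.sum_comm).trans (Finset.sum_comm.trans ?_)
    refine Finset.sum_congr rfl fun e _ => Finset.sum_congr rfl fun c _ => ?_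
    simp only [Finset.mul_sum, mul_assoc]
  have h3 : ∑ c, ∑ d, (∑ e, christoffel g d c e x * (g x)⁻¹ e c) * om d x
      = ∑ a, ∑ b, (g x)⁻¹ a b * ∑ c, christoffel g c a b x * om c x := by
    simp only [Finset.sum_mul, Finset.mul_sum]
    refine Finset.sum_congr rfl fun c _ => ?_
    rw [Finset.sum_comm]
    refine Finset.sum_congr rfl fun d _ => Finset.sum_congr rfl fun e _ => ?_
    rw [hgm.inv_symm hx c d]; ring
  simp only [divergence, h1, pd_inv_metric hgm hU hg hx, neg_mul, add_mul, mul_sub,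
    Finset.sum_add_distrib, Finset.sum_sub_distrib, Finset.sum_neg_distrib, h2, h3]
  ring

end Metric

section ConformalChange

variable {n : ℕ} {U : Set (Pt n)} {g : Met n} {x : Pt n} {φ : Pt n → ℝ} {om : Fin n → Pt n → ℝ}

theorem IsMetricOn.inv_smul (hgm : IsMetricOn g U) (hx : x ∈ U) {c : ℝ} (hc : c ≠ 0) :
    (c • g x)⁻¹ = c⁻¹ • (g x)⁻¹ :=
  Matrix.inv_smul' (g x) (Units.mk0 c hc) (hgm.det_pos hx).ne'.isUnit

/-- The difference `δ^c_b ω_a + δ^c_a ω_b - g_{ab} ω^c` between the Christoffel symbols of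
`e^{2w} g` and of `g`, where `ω = dw`. -/
def confDiff (g : Met n) (om : Fin n → Pt n → ℝ) (c a b : Fin n) (x : Pt n) : ℝ :=
  (if c = b then om a x else 0) + (if c = a then om b x else 0) - g x a b * raise g om c x

/-- The squared norm `g^{cd} ω_c ω_d`. -/
def normSqForm (g : Met n) (om : Fin n → Pt n → ℝ) (x : Pt n) : ℝ :=
  ∑ c, raise g om c x * om c x

theorem sum_inv_mul_metric (hgm : IsMetricOn g U) (hx : x ∈ U) (c b : Fin n) :
    ∑ d, (g x)⁻¹ c d * g x d b = if c = b then 1 else 0 := by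
  rw [← Matrix.mul_apply, hgm.inv_mul hx, Matrix.one_apply]

theorem christoffel_conformal (hgm : IsMetricOn g U) (hU : IsOpen U)
    (hg : ∀ a b, ContDiffOn ℝ 2 (fun y => g y a b) U) (hx : x ∈ U) (hφ : φ x ≠ 0)
    (hφd : DifferentiableAt ℝ φ x) (hom : ∀ a, pd a φ x = 2 * φ x * om a x) (c a b : Fin n) :
    christoffel (fun y => φ y • g y) c a b x = christoffel g c a b x + confDiff g om c a b x := by
  have hgd : ∀ i j, DifferentiableAt ℝ (fun y => g y i j) x := fun i j =>
    (hg i j).differentiableAt_of_isOpen two_ne_zero hU hx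
  have hpd : ∀ e i j, pd e (fun y => (φ y • g y) i j) x
      = 2 * φ x * om e x * g x i j + φ x * pd e (fun y => g y i j) x := by
    intro e i j
    rw [← hom]
    exact pd_mul e hφd (hgd i j)
  have h1 : ∀ i, ∑ d, (g x)⁻¹ c d * g x i d = if c = i then 1 else 0 := by
    intro i
    rw [← sum_inv_mul_metric hgm hx]
    simp only [hgm.symm hx i]
  have h2 : ∀ d, (φ x • g x)⁻¹ c d *
      (pd a (fun y => (φ y • g y) b d) x + pd b (fun y => (φ y • g y) a d) x
        - pd d (fun y => (φ y • g y) a b) x)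
      = (g x)⁻¹ c d * (pd a (fun y => g y b d) x + pd b (fun y => g y a d) x
        - pd d (fun y => g y a b) x)
        + 2 * (om a x * ((g x)⁻¹ c d * g x b d) + om b x * ((g x)⁻¹ c d * g x a d)
          - g x a b * ((g x)⁻¹ c d * om d x)) := by
    intro d
    rw [hpd, hpd, hpd, hgm.inv_smul hx hφ, Matrix.smul_apply, smul_eq_mul]
    field_simp
    ring
  simp only [christoffel, h2, confDiff, raise, Finset.sum_add_distrib, ← Finset.mul_sum,
    Finset.sum_sub_distrib, h1]
  split_ifs <;> ring

theorem confDiff_symm (hgm : IsMetricOn g U) (hx : x ∈ U) (c a b : Fin n) :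
    confDiff g om c a b x = confDiff g om c b a x := by
  simp only [confDiff, hgm.symm hx a b]
  ring

theorem sum_metric_mul_raise (hgm : IsMetricOn g U) (hx : x ∈ U) (a : Fin n) :
    ∑ d, g x a d * raise g om d x = om a x := by
  have h : g x *ᵥ ((g x)⁻¹ *ᵥ fun d => om d x) = fun d => om d x := by
    rw [Matrix.mulVec_mulVec, hgm.mul_inv hx, Matrix.one_mulVec]
  exact congrFun h a

theorem confDiff_trace (hgm : IsMetricOn g U) (hx : x ∈ U) (b : Fin n) :
    ∑ d, confDiff g om d d b x = n * om b x := by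
  simp only [confDiff, hgm.symm hx _ b, Finset.sum_sub_distrib, Finset.sum_add_distrib,
    sum_metric_mul_raise hgm hx]
  simp

theorem inv_contract_confDiff (hgm : IsMetricOn g U) (hx : x ∈ U) (c : Fin n) :
    ∑ a, ∑ b, (g x)⁻¹ a b * confDiff g om c a b x = (2 - n) * raise g om c x := by
  have h1 : ∀ a, ∑ b, (g x)⁻¹ a b * g x a b = 1 := by
    intro a
    have := sum_inv_mul_metric hgm hx a a
    rw [if_pos rfl] at this
    rw [← this]
    exact Finset.sum_congr rfl fun b _ => by rw [hgm.symm hx]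
  have h2 : ∑ a, (g x)⁻¹ a c * om a x = raise g om c x := by
    simp only [raise, fun a => hgm.inv_symm hx a c]
  have h3 : ∑ a, (if c = a then ∑ b, (g x)⁻¹ a b * om b x else 0) = raise g om c x := by
    simp [raise]
  simp only [confDiff, mul_sub, mul_add, Finset.sum_sub_distrib, Finset.sum_add_distrib,
    ← mul_assoc, ← Finset.sum_mul, h1, mul_ite, mul_zero]
  simp only [Finset.sum_ite_eq, Finset.mem_univ, if_true, h2]
  have h4 : ∑ a, ∑ b, (if c = a then (g x)⁻¹ a b * om b x else 0) = raise g om c x := by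
    rw [← h3]
    refine Finset.sum_congr rfl fun a _ => ?_
    split_ifs <;> simp
  rw [h4]
  simp
  ring

theorem inv_contract_confDiff_mul_confDiff (hgm : IsMetricOn g U) (hx : x ∈ U) :
    ∑ a, ∑ b, (g x)⁻¹ a b * ∑ c, ∑ d, confDiff g om d c b x * confDiff g om c a d x
      = (2 - n) * normSqForm g om x := by
  have h1 : ∀ a b, ∑ c, ∑ d, confDiff g om d c b x * confDiff g om c a d x
      = n * om b x * om a x + ∑ d, confDiff g om d a b x * om d x
        - ∑ c, raise g om c x * ∑ d, g x a d * confDiff g om d c b x := by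
    intro a b
    have h : ∀ c, ∑ d, confDiff g om d c b x * confDiff g om c a d x
        = confDiff g om c c b x * om a x
          + (if c = a then ∑ d, confDiff g om d c b x * om d x else 0)
          - raise g om c x * ∑ d, g x a d * confDiff g om d c b x := by
      intro c
      have h' : ∀ d, confDiff g om d c b x * confDiff g om c a d x
          = (if c = d then confDiff g om d c b x * om a x else 0)
            + (if c = a then confDiff g om d c b x * om d x else 0)
            - raise g om c x * (g x a d * confDiff g om d c b x) := by
        intro d
        generalize confDiff g om d c b x = t
        rw [confDiff]
        split_ifs <;> ring
      simp only [h', Finset.sum_sub_distrib, Finset.sum_add_distrib, ← Finset.mul_sum]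
      congr 2
      · simp
      · split_ifs <;> simp
    simp only [h, Finset.sum_sub_distrib, Finset.sum_add_distrib, ← Finset.sum_mul,
      confDiff_trace hgm hx]
    simp
  have h2 : ∑ a, ∑ b, (g x)⁻¹ a b * (n * om b x * om a x) = n * normSqForm g om x := by
    simp only [normSqForm, raise, Finset.sum_mul, Finset.mul_sum]
    refine Finset.sum_congr rfl fun a _ => Finset.sum_congr rfl fun b _ => ?_
    ring
  have h3 : ∑ a, ∑ b, (g x)⁻¹ a b * ∑ d, confDiff g om d a b x * om d x
      = (2 - n) * normSqForm g om x := by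
    simp only [normSqForm, Finset.mul_sum, ← mul_assoc, ← inv_contract_confDiff hgm hx,
      Finset.sum_mul]
    exact (Finset.sum_congr rfl fun a _ => Finset.sum_comm).trans Finset.sum_comm
  have h4 : ∑ a, ∑ b, (g x)⁻¹ a b * ∑ c, raise g om c x * ∑ d, g x a d * confDiff g om d c b x
      = n * normSqForm g om x := by
    have hab : ∀ b, ∑ a, (g x)⁻¹ a b *
        ∑ c, raise g om c x * ∑ d, g x a d * confDiff g om d c b x
        = ∑ c, raise g om c x * confDiff g om b c b x := by
      intro b
      have hv : (g x)⁻¹ *ᵥ (g x *ᵥ fun d => ∑ c, raise g om c x * confDiff g om d c b x)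
          = fun d => ∑ c, raise g om c x * confDiff g om d c b x := by
        rw [Matrix.mulVec_mulVec, hgm.inv_mul hx, Matrix.one_mulVec]
      rw [← show _ = _ from congrFun hv b]
      refine Finset.sum_congr rfl fun a _ => ?_
      rw [hgm.inv_symm hx a b]
      congr 1
      simp only [Matrix.mulVec, dotProduct, Finset.mul_sum]
      rw [Finset.sum_comm]
      refine Finset.sum_congr rfl fun c _ => Finset.sum_congr rfl fun d _ => ?_
      ring
    rw [Finset.sum_comm]
    simp only [hab]
    rw [Finset.sum_comm]
    simp only [← Finset.mul_sum, normSqForm]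
    simp only [fun c => (Finset.sum_congr rfl fun b _ => confDiff_symm hgm hx b c b).trans
      (confDiff_trace (om := om) hgm hx c)]
    rw [Finset.mul_sum]
    refine Finset.sum_congr rfl fun c _ => ?_
    ring
  simp only [h1, mul_add, mul_sub, Finset.sum_add_distrib, Finset.sum_sub_distrib, h2, h3, h4]
  ring

end ConformalChange

section ScalarCurvature

variable {n : ℕ} {U : Set (Pt n)} {g : Met n} {x : Pt n} {φ : Pt n → ℝ} {om : Fin n → Pt n → ℝ}

theorem sum_comm_reverse (F : Fin n → Fin n → Fin n → Fin n → ℝ) :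
    ∑ c, ∑ a, ∑ b, ∑ e, F c a b e = ∑ e, ∑ b, ∑ a, ∑ c, F c a b e := by
  calc
    _ = ∑ a, ∑ c, ∑ b, ∑ e, F c a b e := Finset.sum_comm
    _ = ∑ a, ∑ b, ∑ c, ∑ e, F c a b e := Finset.sum_congr rfl fun _ _ => Finset.sum_comm
    _ = ∑ a, ∑ b, ∑ e, ∑ c, F c a b e :=
      Finset.sum_congr rfl fun _ _ => Finset.sum_congr rfl fun _ _ => Finset.sum_comm
    _ = ∑ b, ∑ a, ∑ e, ∑ c, F c a b e := Finset.sum_comm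
    _ = ∑ b, ∑ e, ∑ a, ∑ c, F c a b e := Finset.sum_congr rfl fun _ _ => Finset.sum_comm
    _ = ∑ e, ∑ b, ∑ a, ∑ c, F c a b e := Finset.sum_comm

theorem sum_comm_cycle (F : Fin n → Fin n → Fin n → Fin n → ℝ) :
    ∑ c, ∑ a, ∑ b, ∑ e, F c a b e = ∑ a, ∑ e, ∑ c, ∑ b, F c a b e := by
  calc
    _ = ∑ a, ∑ c, ∑ b, ∑ e, F c a b e := Finset.sum_comm
    _ = ∑ a, ∑ c, ∑ e, ∑ b, F c a b e :=
      Finset.sum_congr rfl fun _ _ => Finset.sum_congr rfl fun _ _ => Finset.sum_comm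
    _ = ∑ a, ∑ e, ∑ c, ∑ b, F c a b e := Finset.sum_congr rfl fun _ _ => Finset.sum_comm

theorem contDiffOn_christoffel (hgm : IsMetricOn g U) (hU : IsOpen U)
    (hg : ∀ a b, ContDiffOn ℝ 2 (fun y => g y a b) U) (c a b : Fin n) :
    ContDiffOn ℝ 1 (christoffel g c a b) U :=
  contDiffOn_const.mul <| ContDiffOn.sum fun d _ =>
    ((contDiffOn_matrix_inv hg (fun y hy => (hgm.det_pos hy).ne') c d).of_le (by norm_num)).mul
      (((contDiffOn_pd (hg b d) hU a).add (contDiffOn_pd (hg a d) hU b)).sub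
        (contDiffOn_pd (hg a b) hU d))

theorem contDiffOn_confDiff (hgm : IsMetricOn g U)
    (hg : ∀ a b, ContDiffOn ℝ 2 (fun y => g y a b) U) (hom : ∀ a, ContDiffOn ℝ 1 (om a) U)
    (c a b : Fin n) : ContDiffOn ℝ 1 (confDiff g om c a b) U := by
  have h : ∀ (p : Prop) [Decidable p] (i : Fin n),
      ContDiffOn ℝ 1 (fun y => if p then om i y else 0) U := by
    intro p _ i
    split_ifs
    · exact hom i
    · exact contDiffOn_const
  exact ((h _ a).add (h _ b)).sub
    (((hg a b).of_le (by norm_num)).mul (contDiffOn_raise hgm hg hom c))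

theorem inv_contract_confDiff_mul (hgm : IsMetricOn g U) (hx : x ∈ U) (X : Fin n → ℝ) :
    ∑ a, ∑ b, (g x)⁻¹ a b * ∑ c, confDiff g om c a b x * X c
      = (2 - n) * ∑ c, raise g om c x * X c := by
  simp only [Finset.mul_sum, ← mul_assoc, ← inv_contract_confDiff hgm hx, Finset.sum_mul]
  exact (Finset.sum_congr rfl fun a _ => Finset.sum_comm).trans Finset.sum_comm

theorem inv_contract_pd_confDiff (hgm : IsMetricOn g U) (hU : IsOpen U)
    (hg : ∀ a b, ContDiffOn ℝ 2 (fun y => g y a b) U) (hx : x ∈ U)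
    (hom : ∀ a, ContDiffOn ℝ 1 (om a) U) :
    ∑ a, ∑ b, (g x)⁻¹ a b * ∑ c, pd c (confDiff g om c a b) x
      = (2 - n) * ∑ c, pd c (raise g om c) x
        + ∑ a, ∑ b, (g x)⁻¹ a b * ∑ c, ∑ d, christoffel g d c b x * confDiff g om c a d x
        + ∑ a, ∑ b, (g x)⁻¹ a b * ∑ c, ∑ d, confDiff g om d c b x * christoffel g c a d x := by
  have hid : ∀ i j, DifferentiableAt ℝ (fun y => (g y)⁻¹ i j) x := fun i j =>
    (contDiffOn_matrix_inv hg (fun y hy => (hgm.det_pos hy).ne') i j).differentiableAt_of_isOpen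
      two_ne_zero hU hx
  have hTd : ∀ c a b, DifferentiableAt ℝ (confDiff g om c a b) x := fun c a b =>
    (contDiffOn_confDiff hgm hg hom c a b).differentiableAt_of_isOpen one_ne_zero hU hx
  have hrd : ∀ c, DifferentiableAt ℝ (raise g om c) x := fun c =>
    (contDiffOn_raise hgm hg hom c).differentiableAt_of_isOpen one_ne_zero hU hx
  have h1 : ∀ c, ∑ a, ∑ b, (pd c (fun y => (g y)⁻¹ a b) x * confDiff g om c a b x
      + (g x)⁻¹ a b * pd c (confDiff g om c a b) x) = (2 - n) * pd c (raise g om c) x := by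
    intro c
    rw [← pd_const_mul c _ (hrd c), ← pd_congr c hU hx fun y hy => inv_contract_confDiff hgm hy c,
      pd_sum c fun a _ => DifferentiableAt.fun_sum fun b _ => (hid a b).fun_mul (hTd c a b)]
    refine Finset.sum_congr rfl fun a _ => ?_
    rw [pd_sum c fun b _ => (hid a b).fun_mul (hTd c a b)]
    exact Finset.sum_congr rfl fun b _ => (pd_mul c (hid a b) (hTd c a b)).symm
  have h2 : ∑ c, ∑ a, ∑ b, (∑ e, christoffel g a c e x * (g x)⁻¹ e b) * confDiff g om c a b x
      = ∑ a, ∑ b, (g x)⁻¹ a b * ∑ c, ∑ d, confDiff g om d c b x * christoffel g c a d x := by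
    simp only [Finset.sum_mul, Finset.mul_sum]
    rw [sum_comm_reverse]
    refine Finset.sum_congr rfl fun e _ => Finset.sum_congr rfl fun b _ =>
      Finset.sum_congr rfl fun a _ => Finset.sum_congr rfl fun c _ => ?_
    rw [christoffel_symm hgm hU hx a c e]
    ring
  have h3 : ∑ c, ∑ a, ∑ b, (∑ e, christoffel g b c e x * (g x)⁻¹ e a) * confDiff g om c a b x
      = ∑ a, ∑ b, (g x)⁻¹ a b * ∑ c, ∑ d, christoffel g d c b x * confDiff g om c a d x := by
    simp only [Finset.sum_mul, Finset.mul_sum]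
    rw [sum_comm_cycle]
    refine Finset.sum_congr rfl fun a _ => Finset.sum_congr rfl fun e _ =>
      Finset.sum_congr rfl fun c _ => Finset.sum_congr rfl fun b _ => ?_
    rw [hgm.inv_symm hx a e]
    ring
  have h4 : ∑ a, ∑ b, (g x)⁻¹ a b * ∑ c, pd c (confDiff g om c a b) x
      = ∑ c, ∑ a, ∑ b, (g x)⁻¹ a b * pd c (confDiff g om c a b) x := by
    simp only [Finset.mul_sum]
    exact (Finset.sum_congr rfl fun a _ => Finset.sum_comm).trans Finset.sum_comm
  rw [Finset.mul_sum, ← Finset.sum_congr rfl fun c _ => h1 c, h4, ← h2, ← h3]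
  simp only [pd_inv_metric hgm hU hg hx, Finset.sum_add_distrib, neg_mul, add_mul,
    Finset.sum_neg_distrib]
  ring

theorem ricci_conformal (hgm : IsMetricOn g U) (hU : IsOpen U)
    (hg : ∀ a b, ContDiffOn ℝ 2 (fun y => g y a b) U) (hx : x ∈ U)
    (hom : ∀ a, ContDiffOn ℝ 1 (om a) U) (hφ : ∀ y ∈ U, φ y ≠ 0)
    (hφd : ∀ y ∈ U, DifferentiableAt ℝ φ y)
    (hφom : ∀ a, ∀ y ∈ U, pd a φ y = 2 * φ y * om a y) (a b : Fin n) :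
    ricci (fun y => φ y • g y) a b x = ricci g a b x
      + ∑ c, pd c (confDiff g om c a b) x
      - n * (pd a (om b) x - ∑ c, christoffel g c a b x * om c x)
      + ∑ c, confDiff g om c a b x * ∑ d, christoffel g d d c x
      + n * ∑ c, confDiff g om c a b x * om c x
      - ∑ c, ∑ d, christoffel g d c b x * confDiff g om c a d x
      - ∑ c, ∑ d, confDiff g om d c b x * christoffel g c a d x
      - ∑ c, ∑ d, confDiff g om d c b x * confDiff g om c a d x := by
  have hΓd : ∀ c a b, DifferentiableAt ℝ (christoffel g c a b) x := fun c a b =>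
    (contDiffOn_christoffel hgm hU hg c a b).differentiableAt_of_isOpen one_ne_zero hU hx
  have hTd : ∀ c a b, DifferentiableAt ℝ (confDiff g om c a b) x := fun c a b =>
    (contDiffOn_confDiff hgm hg hom c a b).differentiableAt_of_isOpen one_ne_zero hU hx
  have hΓ : ∀ c a b, ∀ y ∈ U, christoffel (fun y => φ y • g y) c a b y
      = christoffel g c a b y + confDiff g om c a b y := fun c a b y hy =>
    christoffel_conformal hgm hU hg hy (hφ y hy) (hφd y hy) (fun a => hφom a y hy) c a b
  have hpΓ : ∀ e c a b, pd e (christoffel (fun y => φ y • g y) c a b) x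
      = pd e (christoffel g c a b) x + pd e (confDiff g om c a b) x := by
    intro e c a b
    rw [pd_congr e hU hx (hΓ c a b), pd_add e (hΓd c a b) (hTd c a b)]
  have htr : ∑ c, pd a (confDiff g om c c b) x = n * pd a (om b) x := by
    rw [← pd_const_mul a _ ((hom b).differentiableAt_of_isOpen one_ne_zero hU hx),
      ← pd_sum a fun c _ => hTd c c b]
    exact pd_congr a hU hx fun y hy => confDiff_trace hgm hy b
  have hT : ∀ Y : Fin n → ℝ, ∑ c, ∑ d, Y c * confDiff g om d d c x = n * ∑ c, Y c * om c x := by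
    intro Y
    rw [Finset.mul_sum]
    refine Finset.sum_congr rfl fun c _ => ?_
    rw [← Finset.mul_sum, confDiff_trace hgm hx]
    ring
  simp only [ricci, hpΓ, hΓ _ _ _ x hx, mul_add, add_mul, Finset.sum_add_distrib, htr, hT]
  simp only [← Finset.mul_sum]
  ring

theorem scalarCurv_conformal (hgm : IsMetricOn g U) (hU : IsOpen U)
    (hg : ∀ a b, ContDiffOn ℝ 2 (fun y => g y a b) U) (hx : x ∈ U)
    (hom : ∀ a, ContDiffOn ℝ 1 (om a) U) (hφ : ∀ y ∈ U, φ y ≠ 0)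
    (hφd : ∀ y ∈ U, DifferentiableAt ℝ φ y)
    (hφom : ∀ a, ∀ y ∈ U, pd a φ y = 2 * φ y * om a y) :
    scalarCurv (fun y => φ y • g y) x = (φ x)⁻¹ * (scalarCurv g x
      - 2 * (n - 1) * divergence g (raise g om) x - (n - 2) * (n - 1) * normSqForm g om x) := by
  have h1 : ∀ a b, (φ x • g x)⁻¹ a b = (φ x)⁻¹ * (g x)⁻¹ a b := by
    intro a b
    rw [hgm.inv_smul hx (hφ x hx), Matrix.smul_apply, smul_eq_mul]
  have hdiv : divergence g (raise g om) x
      = ∑ c, pd c (raise g om c) x + ∑ c, raise g om c x * ∑ d, christoffel g d d c x := by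
    simp only [divergence, Finset.sum_add_distrib]
    congr 1
    exact Finset.sum_congr rfl fun c _ => mul_comm _ _
  have e1 := inv_contract_pd_confDiff hgm hU hg hx hom
  have e2 := divergence_raise hgm hU hg hx hom
  have e3 := inv_contract_confDiff_mul (om := om) hgm hx fun c => ∑ d, christoffel g d d c x
  have e4 := inv_contract_confDiff_mul (om := om) hgm hx fun c => om c x
  have e5 := inv_contract_confDiff_mul_confDiff (om := om) hgm hx
  rw [← show normSqForm g om x = ∑ c, raise g om c x * om c x from rfl] at e4
  simp only [scalarCurv, h1, ricci_conformal hgm hU hg hx hom hφ hφd hφom, mul_assoc,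
    ← Finset.mul_sum]
  congr 1
  have e6 : ∀ Q : Fin n → Fin n → ℝ, ∑ a, ∑ b, (g x)⁻¹ a b * (n * Q a b)
      = n * ∑ a, ∑ b, (g x)⁻¹ a b * Q a b := by
    intro Q
    simp only [Finset.mul_sum]
    exact Finset.sum_congr rfl fun a _ => Finset.sum_congr rfl fun b _ => by ring
  simp only [mul_add _ (_ + _), mul_add _ (_ - _), mul_add, mul_sub ((g x)⁻¹ _ _) (_ - _),
    mul_sub ((g x)⁻¹ _ _) (_ + _), Finset.sum_add_distrib, Finset.sum_sub_distrib, e6]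
  rw [e1, ← e2, e3, e4, e5, hdiv]
  ring

end ScalarCurvature

section ConformalLaplacian

variable {n : ℕ} {U : Set (Pt n)} {g : Met n} {x : Pt n} {φ f z : Pt n → ℝ}
  {om : Fin n → Pt n → ℝ}

theorem divergence_congr (hU : IsOpen U) (hx : x ∈ U) {X Y : Fin n → Pt n → ℝ}
    (h : ∀ c, ∀ y ∈ U, X c y = Y c y) : divergence g X x = divergence g Y x :=
  Finset.sum_congr rfl fun c _ => by rw [pd_congr c hU hx (h c), h c x hx]

theorem divergence_add {X Y : Fin n → Pt n → ℝ} (hX : ∀ c, DifferentiableAt ℝ (X c) x)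
    (hY : ∀ c, DifferentiableAt ℝ (Y c) x) :
    divergence g (fun c y => X c y + Y c y) x = divergence g X x + divergence g Y x := by
  simp only [divergence, fun c => pd_add c (hX c) (hY c), ← Finset.sum_add_distrib]
  exact Finset.sum_congr rfl fun c _ => by ring

theorem divergence_mul {w : Pt n → ℝ} {X : Fin n → Pt n → ℝ} (hw : DifferentiableAt ℝ w x)
    (hX : ∀ c, DifferentiableAt ℝ (X c) x) :
    divergence g (fun c y => w y * X c y) x
      = ∑ c, pd c w x * X c x + w x * divergence g X x := by
  simp only [divergence, fun c => pd_mul c hw (hX c), Finset.mul_sum, ← Finset.sum_add_distrib]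
  exact Finset.sum_congr rfl fun c _ => by ring

theorem sum_raise_mul_comm (hgm : IsMetricOn g U) (hx : x ∈ U) (om' : Fin n → Pt n → ℝ) :
    ∑ c, om c x * raise g om' c x = ∑ c, om' c x * raise g om c x := by
  simp only [raise, Finset.mul_sum]
  rw [Finset.sum_comm]
  refine Finset.sum_congr rfl fun c _ => Finset.sum_congr rfl fun d _ => ?_
  rw [hgm.inv_symm hx c d]
  ring

theorem laplaceBeltrami_congr (hU : IsOpen U) (hx : x ∈ U) {u v : Pt n → ℝ}
    (h : ∀ y ∈ U, u y = v y) : laplaceBeltrami g u x = laplaceBeltrami g v x := by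
  simp only [laplaceBeltrami]
  congr 1
  refine Finset.sum_congr rfl fun a _ => pd_congr a hU hx fun y hy => ?_
  simp only [fun b => pd_congr b hU hy h]

theorem confLap_congr (hU : IsOpen U) (hx : x ∈ U) {u v : Pt n → ℝ}
    (h : ∀ y ∈ U, u y = v y) : confLap g u x = confLap g v x := by
  rw [confLap, confLap, laplaceBeltrami_congr hU hx h, h x hx]

theorem IsMetricOn.conformal (hgm : IsMetricOn g U) (hφ : ∀ y ∈ U, 0 < φ y) :
    IsMetricOn (fun y => φ y • g y) U := fun y hy =>
  ⟨(hgm y hy).1.smul _, (hgm y hy).2.smul (hφ y hy)⟩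

theorem laplaceBeltrami_mul (hgm : IsMetricOn g U) (hU : IsOpen U)
    (hg : ∀ a b, ContDiffOn ℝ 2 (fun y => g y a b) U) (hx : x ∈ U)
    (hf : ContDiffOn ℝ 2 f U) (hz : ContDiffOn ℝ 2 z U) :
    laplaceBeltrami g (fun y => f y * z y) x = z x * laplaceBeltrami g f x
      + f x * laplaceBeltrami g z x - 2 * ∑ c, pd c f x * raise g (fun b => pd b z) c x := by
  have hrd : ∀ {u : Pt n → ℝ}, ContDiffOn ℝ 2 u U → ∀ c,
      DifferentiableAt ℝ (raise g (fun b => pd b u) c) x := fun hu c =>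
    (contDiffOn_raise hgm hg (fun b => contDiffOn_pd hu hU b) c).differentiableAt_of_isOpen
      one_ne_zero hU hx
  have hd : ∀ {u : Pt n → ℝ}, ContDiffOn ℝ 2 u U → ∀ y ∈ U, DifferentiableAt ℝ u y :=
    fun hu y hy => hu.differentiableAt_of_isOpen two_ne_zero hU hy
  have h1 : ∀ c, ∀ y ∈ U, raise g (fun b => pd b fun y => f y * z y) c y
      = z y * raise g (fun b => pd b f) c y + f y * raise g (fun b => pd b z) c y := by
    intro c y hy
    simp only [raise, fun b => pd_mul b (hd hf y hy) (hd hz y hy), Finset.mul_sum,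
      ← Finset.sum_add_distrib]
    exact Finset.sum_congr rfl fun d _ => by ring
  rw [laplaceBeltrami_eq_neg_divergence hgm hU hg hx (hf.mul hz), divergence_congr hU hx h1,
    divergence_add (fun c => (hd hz x hx).fun_mul (hrd hf c))
      (fun c => (hd hf x hx).fun_mul (hrd hz c)),
    divergence_mul (hd hz x hx) (hrd hf), divergence_mul (hd hf x hx) (hrd hz),
    laplaceBeltrami_eq_neg_divergence hgm hU hg hx hf,
    laplaceBeltrami_eq_neg_divergence hgm hU hg hx hz,
    sum_raise_mul_comm (om := fun b => pd b z) hgm hx]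
  ring

theorem laplaceBeltrami_conformal (hgm : IsMetricOn g U) (hU : IsOpen U)
    (hg : ∀ a b, ContDiffOn ℝ 2 (fun y => g y a b) U) (hx : x ∈ U)
    (hφ : ∀ y ∈ U, 0 < φ y) (hφc : ContDiffOn ℝ 2 φ U)
    (hφom : ∀ a, ∀ y ∈ U, pd a φ y = 2 * φ y * om a y) (hz : ContDiffOn ℝ 2 z U) :
    laplaceBeltrami (fun y => φ y • g y) z x = (φ x)⁻¹ * (laplaceBeltrami g z x
      - (n - 2) * ∑ c, om c x * raise g (fun b => pd b z) c x) := by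
  have hφd : ∀ y ∈ U, DifferentiableAt ℝ φ y := fun y hy =>
    hφc.differentiableAt_of_isOpen two_ne_zero hU hy
  have hφx := (hφ x hx).ne'
  have hrd : ∀ c, DifferentiableAt ℝ (raise g (fun b => pd b z) c) x := fun c =>
    (contDiffOn_raise hgm hg (fun b => contDiffOn_pd hz hU b) c).differentiableAt_of_isOpen
      one_ne_zero hU hx
  have h1 : ∀ c, ∀ y ∈ U, raise (fun y => φ y • g y) (fun b => pd b z) c y
      = (φ y)⁻¹ * raise g (fun b => pd b z) c y := by
    intro c y hy
    simp only [raise, hgm.inv_smul hy (hφ y hy).ne', Matrix.smul_apply, smul_eq_mul, mul_assoc,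
      Finset.mul_sum]
  have h2 : ∀ X : Fin n → Pt n → ℝ, divergence (fun y => φ y • g y) X x
      = divergence g X x + n * ∑ c, om c x * X c x := by
    intro X
    simp only [divergence, christoffel_conformal hgm hU hg hx hφx (hφd x hx)
      (fun a => hφom a x hx), Finset.sum_add_distrib, confDiff_trace hgm hx, Finset.mul_sum,
      add_mul, mul_assoc]
    ring
  have h3 : ∀ c, pd c (fun y => (φ y)⁻¹) x = -2 * (φ x)⁻¹ * om c x := by
    intro c
    rw [pd_comp c (hasDerivAt_inv hφx) (hφd x hx), hφom c x hx]
    field_simp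
  rw [laplaceBeltrami_eq_neg_divergence (hgm.conformal hφ) hU (fun a b => hφc.mul (hg a b)) hx hz,
    divergence_congr hU hx h1, h2, divergence_mul ((hφd x hx).fun_inv hφx) hrd,
    laplaceBeltrami_eq_neg_divergence hgm hU hg hx hz]
  have h4 : ∑ c, pd c (fun y => (φ y)⁻¹) x * raise g (fun b => pd b z) c x
      = -2 * (φ x)⁻¹ * ∑ c, om c x * raise g (fun b => pd b z) c x := by
    simp only [h3, Finset.mul_sum, mul_assoc]
  have h5 : ∑ c, om c x * ((φ x)⁻¹ * raise g (fun b => pd b z) c x)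
      = (φ x)⁻¹ * ∑ c, om c x * raise g (fun b => pd b z) c x := by
    rw [Finset.mul_sum]
    exact Finset.sum_congr rfl fun c _ => by ring
  rw [h4, h5]
  ring

theorem pd_rpow (hf : DifferentiableAt ℝ f x) (hfx : 0 < f x) (q : ℝ) (a : Fin n) :
    pd a (fun y => f y ^ q) x = 2 * f x ^ q * (q / 2 * (f x)⁻¹ * pd a f x) := by
  rw [pd_comp a (Real.hasDerivAt_rpow_const (Or.inl hfx.ne')) hf, Real.rpow_sub_one hfx.ne']
  field_simp

theorem conformal_exponent_eq (hn : 3 ≤ n) :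
    2 * (n : ℝ) / ((n : ℝ) - 2) - 2 = 4 / ((n : ℝ) - 2) := by
  have : (3 : ℝ) ≤ n := by exact_mod_cast hn
  have h : (n : ℝ) - 2 ≠ 0 := by linarith
  field_simp
  ring

theorem confLap_mul (hn : 3 ≤ n) (hgm : IsMetricOn g U) (hU : IsOpen U)
    (hg : ∀ a b, ContDiffOn ℝ 2 (fun y => g y a b) U) (hx : x ∈ U)
    (hf : ContDiffOn ℝ 2 f U) (hfp : ∀ y ∈ U, 0 < f y) (hz : ContDiffOn ℝ 2 z U) :
    confLap g (fun y => f y * z y) x = z x * confLap g f x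
      + f x * f x ^ (2 * (n : ℝ) / ((n : ℝ) - 2) - 2) *
        laplaceBeltrami (fun y => (f y ^ (2 * (n : ℝ) / ((n : ℝ) - 2) - 2)) • g y) z x := by
  have hn' : (n : ℝ) - 2 ≠ 0 := by
    have : (3 : ℝ) ≤ n := by exact_mod_cast hn
    linarith
  rw [conformal_exponent_eq hn]
  have hfx := (hfp x hx).ne'
  have hp : 0 < f x ^ (4 / ((n : ℝ) - 2)) := Real.rpow_pos_of_pos (hfp x hx) _
  rw [laplaceBeltrami_conformal hgm hU hg hx (fun y hy => Real.rpow_pos_of_pos (hfp y hy) _)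
    (hf.rpow_const_of_ne fun y hy => (hfp y hy).ne')
    (fun a y hy => pd_rpow (hf.differentiableAt_of_isOpen two_ne_zero hU hy) (hfp y hy) _ a) hz]
  simp only [mul_assoc, ← Finset.mul_sum]
  rw [confLap, confLap, laplaceBeltrami_mul hgm hU hg hx hf hz]
  field_simp
  ring

theorem scalarCurv_rpow_conformal (hn : 3 ≤ n) (hgm : IsMetricOn g U) (hU : IsOpen U)
    (hg : ∀ a b, ContDiffOn ℝ 2 (fun y => g y a b) U) (hx : x ∈ U)
    (hf : ContDiffOn ℝ 2 f U) (hfp : ∀ y ∈ U, 0 < f y) :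
    scalarCurv (fun y => (f y ^ (2 * (n : ℝ) / ((n : ℝ) - 2) - 2)) • g y) x
      = (f x ^ (2 * (n : ℝ) / ((n : ℝ) - 2) - 2))⁻¹ * (4 * ((n : ℝ) - 1) / ((n : ℝ) - 2))
        * (f x)⁻¹ * confLap g f x := by
  have hn3 : (3 : ℝ) ≤ n := by exact_mod_cast hn
  have hn2 : (n : ℝ) - 2 ≠ 0 := by linarith
  have hn1 : (n : ℝ) - 1 ≠ 0 := by linarith
  rw [conformal_exponent_eq hn]
  set q : ℝ := 4 / ((n : ℝ) - 2) with hq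
  let om : Fin n → Pt n → ℝ := fun a y => q / 2 * (f y)⁻¹ * pd a f y
  have hfx := (hfp x hx).ne'
  have hfd : ∀ y ∈ U, DifferentiableAt ℝ f y := fun y hy =>
    hf.differentiableAt_of_isOpen two_ne_zero hU hy
  have hwc : ContDiffOn ℝ 1 (fun y => q / 2 * (f y)⁻¹) U :=
    contDiffOn_const.mul ((hf.of_le (by norm_num)).inv fun y hy => (hfp y hy).ne')
  have hom : ∀ a, ContDiffOn ℝ 1 (om a) U := fun a => hwc.mul (contDiffOn_pd hf hU a)
  have hr : ∀ c y, raise g om c y = q / 2 * (f y)⁻¹ * raise g (fun b => pd b f) c y := by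
    intro c y
    simp only [raise, om, Finset.mul_sum]
    exact Finset.sum_congr rfl fun d _ => by ring
  have hrd : ∀ c, DifferentiableAt ℝ (raise g (fun b => pd b f) c) x := fun c =>
    (contDiffOn_raise hgm hg (fun b => contDiffOn_pd hf hU b) c).differentiableAt_of_isOpen
      one_ne_zero hU hx
  have hpw : ∀ c, pd c (fun y => q / 2 * (f y)⁻¹) x = -(q / 2 * (f x)⁻¹ ^ 2) * pd c f x := by
    intro c
    rw [pd_const_mul c _ ((hfd x hx).fun_inv hfx), pd_comp c (hasDerivAt_inv hfx) (hfd x hx)]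
    field_simp
  have hN : normSqForm g om x = (q / 2 * (f x)⁻¹) ^ 2 * normSqForm g (fun b => pd b f) x := by
    simp only [normSqForm, hr, om, Finset.mul_sum]
    exact Finset.sum_congr rfl fun c _ => by ring
  have hdiv : divergence g (raise g om) x = -(q / 2 * (f x)⁻¹ ^ 2)
      * normSqForm g (fun b => pd b f) x
      + q / 2 * (f x)⁻¹ * divergence g (raise g fun b => pd b f) x := by
    rw [divergence_congr hU hx fun c y _ => hr c y,
      divergence_mul (hwc.differentiableAt_of_isOpen one_ne_zero hU hx) hrd]
    congr 1
    simp only [hpw, normSqForm, Finset.mul_sum]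
    exact Finset.sum_congr rfl fun c _ => by ring
  rw [scalarCurv_conformal (om := om) hgm hU hg hx hom
    (fun y hy => (Real.rpow_pos_of_pos (hfp y hy) _).ne')
    (fun y hy => (hfd y hy).rpow_const (Or.inl (hfp y hy).ne'))
    (fun a y hy => pd_rpow (hfd y hy) (hfp y hy) _ a), hN, hdiv, confLap,
    laplaceBeltrami_eq_neg_divergence hgm hU hg hx hf]
  generalize (f x ^ q)⁻¹ = P
  rw [hq]
  field_simp
  ring

end ConformalLaplacian

/-- Proposition 2.4: coordinates are conformal harmonic iff they are harmonic
coordinates for a scalar-flat conformal rescaling `f^{p-2} g`, `p = 2n/(n-2)`. -/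
theorem conformal_harmonic_iff_harmonic_for_scalar_flat
    (n k : ℕ) (hn : 3 ≤ n) (hk : 2 ≤ k) (α : ℝ) (hα : α ∈ Set.Ioo (0 : ℝ) 1)
    (U : Set (Pt n)) (hU : IsOpen U)
    (g : Met n) (hgm : IsMetricOn g U) (hgr : MetCHolderOn k α U g)
    (Z : Pt n → Pt n) (hZreg : ∀ i, ContDiffOn ℝ 2 (fun x => Z x i) U)
    (hZdiff : ∀ x ∈ U, IsUnit (jac Z x)) :
    (∃ (F : Fin n → Pt n → ℝ) (f : Pt n → ℝ),
        (∀ i, ContDiffOn ℝ 2 (F i) U) ∧ ContDiffOn ℝ 2 f U ∧ (∀ x ∈ U, 0 < f x) ∧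
        (∀ i, ∀ x ∈ U, confLap g (F i) x = 0) ∧ (∀ x ∈ U, confLap g f x = 0) ∧
        (∀ i, ∀ x ∈ U, Z x i = F i x / f x))
    ↔
    (∃ f : Pt n → ℝ, ContDiffOn ℝ 2 f U ∧ (∀ x ∈ U, 0 < f x) ∧
        (∀ x ∈ U,
          scalarCurv (fun y => (f y ^ (2 * (n : ℝ) / ((n : ℝ) - 2) - 2)) • g y) x = 0) ∧
        (∀ i, ∀ x ∈ U,
          laplaceBeltrami (fun y => (f y ^ (2 * (n : ℝ) / ((n : ℝ) - 2) - 2)) • g y)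
            (fun y => Z y i) x = 0)) := by
  have hg : ∀ a b, ContDiffOn ℝ 2 (fun y => g y a b) U := fun a b =>
    (hgr a b).1.of_le (by exact_mod_cast hk)
  have hn3 : (3 : ℝ) ≤ n := by exact_mod_cast hn
  have hn2 : (n : ℝ) - 2 ≠ 0 := by linarith
  have hn1 : (n : ℝ) - 1 ≠ 0 := by linarith
  constructor
  · rintro ⟨F, f, -, hf, hfp, hLF, hLf, hZ⟩
    refine ⟨f, hf, hfp, fun x hx => ?_, fun i x hx => ?_⟩
    · rw [scalarCurv_rpow_conformal hn hgm hU hg hx hf hfp, hLf x hx, mul_zero]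
    · have h := confLap_mul hn hgm hU hg hx hf hfp (hZreg i)
      have hFZ : ∀ y ∈ U, f y * Z y i = F i y := fun y hy => by
        rw [hZ i y hy, mul_div_cancel₀ _ (hfp y hy).ne']
      rw [confLap_congr hU hx hFZ, hLF i x hx, hLf x hx, mul_zero, zero_add] at h
      exact (mul_eq_zero.1 h.symm).resolve_left
        (mul_pos (hfp x hx) (Real.rpow_pos_of_pos (hfp x hx) _)).ne'
  · rintro ⟨f, hf, hfp, hR, hΔ⟩
    have hLf : ∀ x ∈ U, confLap g f x = 0 := by
      intro x hx
      have h := hR x hx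
      rw [scalarCurv_rpow_conformal hn hgm hU hg hx hf hfp] at h
      refine (mul_eq_zero.1 h).resolve_left ?_
      exact mul_ne_zero (mul_ne_zero (inv_ne_zero (Real.rpow_pos_of_pos (hfp x hx) _).ne')
        (div_ne_zero (mul_ne_zero four_ne_zero hn1) hn2)) (inv_ne_zero (hfp x hx).ne')
    refine ⟨fun i y => f y * Z y i, f, fun i => hf.mul (hZreg i), hf, hfp, fun i x hx => ?_, hLf,
      fun i x hx => ?_⟩
    · rw [confLap_mul hn hgm hU hg hx hf hfp (hZreg i), hLf x hx, hΔ i x hx, mul_zero, mul_zero,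
        add_zero]
    · rw [mul_div_cancel_left₀ _ (hfp x hx).ne']
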